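/- Assume f satisfies (f1), (f2) and that s ↦ s·f′(s)/f(s) is decreasing for s ≥ β. Then s ↦ s·f(s)/F(s) is decreasing on (β,∞). -/

import Mathlib

open Set Filter MeasureTheory Topology

noncomputable section

/-- `F(s) = ∫₀ˢ f(t) dt`. -/
def Fint (f : ℝ → ℝ) (s : ℝ) : ℝ := ∫ t in (0:ℝ)..s, f t

/-- `s ∈ (−c, c)` where `c ∈ (0, ∞]` is viewed as an extended real. -/
def InCC (c : EReal) (s : ℝ) : Prop := -c < (s : EReal) ∧ (s : EReal) < c

/-- A solution of equation (E):  `u'' + (q'/q) u' + f(u) = 0` on `(0,∞)`,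
`u` with values in `(−c,c)`, `C¹` on `[0,∞)`, twice differentiable on `(0,∞)`,
and `u'(0) = 0`. -/
structure IsSolutionE (c : EReal) (f q u : ℝ → ℝ) : Prop where
  mem : ∀ r : ℝ, 0 ≤ r → InCC c (u r)
  c1 : ContDiffOn ℝ 1 u (Ici (0:ℝ))
  diff2 : ∀ r : ℝ, 0 < r → DifferentiableAt ℝ (deriv u) r
  ode : ∀ r : ℝ, 0 < r →
    deriv (deriv u) r + (deriv q r / q r) * deriv u r + f (u r) = 0
  d0 : deriv u 0 = 0

/-- Condition (f1). -/
def CondF1 (c : EReal) (f : ℝ → ℝ) (b β : ℝ) : Prop :=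
  (∀ s : ℝ, f (-s) = - f s) ∧ f 0 = 0 ∧
  0 < b ∧ b < β ∧ (β : EReal) < c ∧
  (∀ s : ℝ, b < s → (s : EReal) < c → 0 < f s) ∧
  (∀ s : ℝ, s ∈ Icc (0:ℝ) b → f s ≤ 0) ∧
  (∃ s ∈ Icc (0:ℝ) b, f s ≠ 0) ∧
  Fint f β = 0

/-- Condition (f2). -/
def CondF2 (c : EReal) (f : ℝ → ℝ) : Prop :=
  ContDiffOn ℝ 1 f {s : ℝ | 0 < s ∧ (s : EReal) < c} ∧
  IntegrableOn (deriv f) (Ioo (0:ℝ) 1)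

/-- Condition (q1). -/
def CondQ1 (q : ℝ → ℝ) : Prop :=
  ContDiffOn ℝ 1 q (Ioi (0:ℝ)) ∧
  (∀ r : ℝ, 0 < r → 0 < q r ∧ 0 < deriv q r) ∧
  q 0 = 0 ∧ ContinuousWithinAt q (Ici (0:ℝ)) 0

/-- Condition (q2). -/
def CondQ2 (q : ℝ → ℝ) : Prop :=
  StrictAntiOn (fun r => deriv q r / q r) (Ioi (0:ℝ))

/-- `Q(r) = ∫₀ʳ q(s) ds`. -/
def Qint (q : ℝ → ℝ) (r : ℝ) : ℝ := ∫ s in (0:ℝ)..r, q s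

/-- `H = (Q/q)'`. -/
def Hfun (q : ℝ → ℝ) (r : ℝ) : ℝ := deriv (fun t => Qint q t / q t) r

/-- Condition (q3), with `Hinf = H∞`. -/
def CondQ3 (q : ℝ → ℝ) (Hinf : ℝ) : Prop :=
  AntitoneOn (Hfun q) (Ioi (0:ℝ)) ∧
  (∃ H0 : ℝ, Tendsto (Hfun q) (nhdsWithin 0 (Ioi 0)) (nhds H0) ∧ H0 < 1/2) ∧
  Tendsto (Hfun q) atTop (nhds Hinf) ∧ 0 < Hinf ∧
  MonotoneOn (fun r => q r * (Hfun q r - Hinf)) (Ioi (0:ℝ))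

/-- Condition (f3). -/
def CondF3 (c : EReal) (f : ℝ → ℝ) (β Hinf : ℝ) : Prop :=
  ∀ s : ℝ, β < s → (s : EReal) < c →
    (1 - 2 * Hinf) / 2 ≤ deriv (fun t => Fint f t / f t) s

/-- `h(r) = q(r) ∫_r^∞ ds / q(s)`. -/
def hfun (q : ℝ → ℝ) (r : ℝ) : ℝ := q r * ∫ s in Ioi r, 1 / q s

/-- Condition (q4), with `linf = ℓ∞`. -/
def CondQ4 (q : ℝ → ℝ) (linf : ℝ) : Prop :=
  IntegrableOn (fun r => 1 / q r) (Ioi (1:ℝ)) ∧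
  ¬ IntegrableOn (fun r => 1 / q r) (Ioo (0:ℝ) 1) ∧
  (∀ r : ℝ, 0 < r → 0 < deriv (hfun q) r) ∧
  AntitoneOn (deriv (hfun q)) (Ioi (0:ℝ)) ∧
  Tendsto (deriv (hfun q)) atTop (nhds linf) ∧ 0 < linf

/-- Condition (f4): `s ↦ s f'(s)/f(s)` is decreasing for `s ≥ b`. -/
def CondF4 (c : EReal) (f : ℝ → ℝ) (b : ℝ) : Prop :=
  StrictAntiOn (fun s => s * deriv f s / f s) {s : ℝ | b ≤ s ∧ (s : EReal) < c}

/-- Condition (q5). -/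
def CondQ5 (q : ℝ → ℝ) : Prop :=
  StrictMonoOn (fun r => deriv q r * q r) (Ioi (0:ℝ))

/-- Condition (f5). -/
def CondF5 (c : EReal) (f : ℝ → ℝ) (b : ℝ) : Prop :=
  ∀ s : ℝ, b ≤ s → (s : EReal) < c → deriv f s * (s - b) ≤ f s

/-- Condition (f6). -/
def CondF6 (f : ℝ → ℝ) (β linf : ℝ) : Prop :=
  β * deriv f β / f β ≤ 1 + 2 * linf

/-- `G(r) = (q'/(q h)) ∫₀ʳ h − 1/2`. -/
def Gfun (q : ℝ → ℝ) (r : ℝ) : ℝ :=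
  deriv q r / (q r * hfun q r) * (∫ s in (0:ℝ)..r, hfun q s) - 1/2

/-- Condition (q6), with `Gbar = sup_{r>0} G(r)`. -/
def CondQ6 (q : ℝ → ℝ) (Gbar : ℝ) : Prop :=
  (∀ r : ℝ, 0 < r → 0 ≤ Gfun q r) ∧
  IsLUB (Gfun q '' Ioi (0:ℝ)) Gbar ∧
  MonotoneOn (fun r => Gfun q r * hfun q r / Real.sqrt (∫ s in (0:ℝ)..r, hfun q s))
    (Ioi (0:ℝ))

/-- Condition (q7), with constant `C`. -/
def CondQ7 (q : ℝ → ℝ) (Gbar C : ℝ) : Prop :=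
  Gbar ≤ C ∧ C ≤ 1 ∧
  ∃ a : ℝ, a ∈ Ioo (0:ℝ) 1 ∧
    MonotoneOn (fun r => hfun q r ^ (1 - a) * (C - Gfun q r)) (Ioi (0:ℝ))

/-- Condition (f7). -/
def CondF7 (c : EReal) (f : ℝ → ℝ) (β C : ℝ) : Prop :=
  ∀ s : ℝ, β < s → (s : EReal) < c → C ≤ deriv (fun t => Fint f t / f t) s

/-- `u` has exactly `k` sign changes on `(0,∞)`: there are
`0 = z₀ < z₁ < ⋯ < z_k` such that for `i = 0,…,k` the function `(−1)^i u`
is nonnegative and not identically zero on `[z_i, z_{i+1}]` (with `z_{k+1} = ∞`). -/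
def ExactSignChanges (u : ℝ → ℝ) (k : ℕ) : Prop :=
  ∃ z : ℕ → ℝ, z 0 = 0 ∧ (∀ i, i < k → z i < z (i + 1)) ∧
    ∀ i, i ≤ k →
      (∀ r ∈ (if i < k then Icc (z i) (z (i + 1)) else Ici (z i)),
        0 ≤ (-1 : ℝ) ^ i * u r) ∧
      ∃ r ∈ (if i < k then Icc (z i) (z (i + 1)) else Ici (z i)),
        (-1 : ℝ) ^ i * u r ≠ 0

/-- A first variation `φ` along a solution `u` of (E). -/
structure IsFirstVariation (c : EReal) (f q u φ : ℝ → ℝ) : Prop where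
  c1 : ContDiffOn ℝ 1 φ (Ici (0:ℝ))
  init : φ 0 = 1
  dinit : deriv φ 0 = 0
  diff2 : ∀ r : ℝ, 0 < r → u r ≠ 0 → DifferentiableAt ℝ (deriv φ) r
  ode : ∀ r : ℝ, 0 < r → u r ≠ 0 →
    deriv (deriv φ) r + (deriv q r / q r) * deriv φ r + deriv f (u r) * φ r = 0

/-- The filter of approach to `Z ∈ (0,∞]` from the left. -/
def leftFilter (Z : EReal) : Filter ℝ :=
  if Z = ⊤ then atTop else nhdsWithin Z.toReal (Iio Z.toReal)

/-- `Z₁` for a single solution `w`: the supremum of the radii `r > 0` such that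
`w > 0` and `w' < 0 ` on `(0,r)`. -/
def Z1 (w : ℝ → ℝ) : EReal :=
  sSup {z : EReal | ∃ r : ℝ, z = (r : EReal) ∧ 0 < r ∧
    ∀ s : ℝ, 0 < s → s < r → 0 < w s ∧ deriv w s < 0}

lemma isOpen_setOf_pos_and_coe_lt (c : EReal) : IsOpen {s : ℝ | 0 < s ∧ (s : EReal) < c} :=
  (isOpen_lt continuous_const continuous_id).inter
    (isOpen_lt continuous_coe_real_ereal continuous_const)

/-- A function that is differentiable on `(0, a]` with integrable derivative is bounded there,
hence integrable. -/
lemma intervalIntegrable_of_integrableOn_deriv {f : ℝ → ℝ} {a : ℝ} (ha : 0 < a)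
    (hf : ∀ x ∈ Ioc 0 a, DifferentiableAt ℝ f x) (hf' : IntegrableOn (deriv f) (Ioc 0 a)) :
    IntervalIntegrable f volume 0 a := by
  rw [intervalIntegrable_iff_integrableOn_Ioc_of_le ha.le]
  have hcont : ContinuousOn f (Ioc 0 a) := fun x hx =>
    (hf x hx).continuousAt.continuousWithinAt
  refine Integrable.of_bound (hcont.aestronglyMeasurable measurableSet_Ioc)
    (|f a| + ∫ t in Ioc 0 a, ‖deriv f t‖) ?_
  refine (ae_restrict_iff' measurableSet_Ioc).2 (ae_of_all _ fun x hx => ?_)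
  have hsub : Ioc x a ⊆ Ioc 0 a := Ioc_subset_Ioc_left hx.1.le
  have hftc : ∫ t in x..a, deriv f t = f a - f x := by
    refine intervalIntegral.integral_deriv_eq_sub (fun t ht => ?_) ?_
    · rw [uIcc_of_le hx.2] at ht
      exact hf t ⟨hx.1.trans_le ht.1, ht.2⟩
    · rw [intervalIntegrable_iff_integrableOn_Ioc_of_le hx.2]
      exact hf'.mono_set hsub
  have hbound : |f a - f x| ≤ ∫ t in Ioc 0 a, ‖deriv f t‖ := by
    rw [← hftc, intervalIntegral.integral_of_le hx.2, ← Real.norm_eq_abs]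
    exact (norm_integral_le_integral_norm _).trans
      (setIntegral_mono_set hf'.norm (ae_of_all _ fun t => norm_nonneg _) hsub.eventuallyLE)
  rw [Real.norm_eq_abs]
  have := abs_sub_abs_le_abs_sub (f x) (f a)
  rw [abs_sub_comm] at this
  linarith

namespace CondF2

variable {c : EReal} {f : ℝ → ℝ}

lemma differentiableAt (h : CondF2 c f) {s : ℝ} (hs : 0 < s) (hsc : (s : EReal) < c) :
    DifferentiableAt ℝ f s :=
  (h.1.differentiableOn one_ne_zero).differentiableAt
    ((isOpen_setOf_pos_and_coe_lt c).mem_nhds ⟨hs, hsc⟩)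

lemma intervalIntegrable (h : CondF2 c f) {s : ℝ} (hs : 0 < s) (hsc : (s : EReal) < c) :
    IntervalIntegrable f volume 0 s := by
  have hlt : ∀ {x : ℝ}, x ≤ s → (x : EReal) < c := fun hx =>
    (EReal.coe_le_coe_iff.2 hx).trans_lt hsc
  have ha : 0 < min s (1 / 2) := lt_min hs (by norm_num)
  have has : min s (1 / 2) ≤ s := min_le_left _ _
  refine (intervalIntegrable_of_integrableOn_deriv ha
    (fun x hx => h.differentiableAt hx.1 (hlt (hx.2.trans has)))
    (h.2.mono_set fun x hx => ⟨hx.1, ?_⟩)).trans (ContinuousOn.intervalIntegrable fun x hx => ?_)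
  · exact (hx.2.trans (min_le_right _ _)).trans_lt (by norm_num)
  · rw [uIcc_of_le has] at hx
    exact (h.differentiableAt (ha.trans_le hx.1) (hlt hx.2)).continuousAt.continuousWithinAt

lemma hasDerivAt_Fint (h : CondF2 c f) {s : ℝ} (hs : 0 < s) (hsc : (s : EReal) < c) :
    HasDerivAt (Fint f) (f s) s :=
  intervalIntegral.integral_hasDerivAt_right (h.intervalIntegrable hs hsc)
    (h.1.continuousOn.stronglyMeasurableAtFilter (isOpen_setOf_pos_and_coe_lt c) s ⟨hs, hsc⟩)
    (h.differentiableAt hs hsc).continuousAt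

end CondF2

/-- If `s ↦ s f'(s)/f(s)` is decreasing for `s ≥ β`, then
`s ↦ s f(s)/F(s)` is decreasing on `(β, ∞)` (inside `(0,c)`). -/
theorem sf_over_F_decreasing
    (c : EReal) (f : ℝ → ℝ) (b β : ℝ) (hc : 0 < c)
    (hf1 : CondF1 c f b β) (hf2 : CondF2 c f)
    (hdec : StrictAntiOn (fun s => s * deriv f s / f s)
      {s : ℝ | β ≤ s ∧ (s : EReal) < c}) :
    StrictAntiOn (fun s => s * f s / Fint f s)
      {s : ℝ | β < s ∧ (s : EReal) < c} := by
  obtain ⟨-, -, hb, hbβ, -, hpos, -, -, hFβ⟩ := hf1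
  have hβ : 0 < β := hb.trans hbβ
  have hlt : ∀ {x s : ℝ}, x ≤ s → (s : EReal) < c → (x : EReal) < c := fun hx hsc =>
    (EReal.coe_le_coe_iff.2 hx).trans_lt hsc
  have hdF : ∀ {s : ℝ}, β ≤ s → (s : EReal) < c → HasDerivAt (Fint f) (f s) s :=
    fun hs hsc => hf2.hasDerivAt_Fint (hβ.trans_le hs) hsc
  have hdsf : ∀ {s : ℝ}, β ≤ s → (s : EReal) < c →
      HasDerivAt (fun t => t * f t) (1 * f s + s * deriv f s) s := fun hs hsc =>
    (hasDerivAt_id' _).mul (hf2.differentiableAt (hβ.trans_le hs) hsc).hasDerivAt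
  have hFpos : ∀ {s : ℝ}, β < s → (s : EReal) < c → 0 < Fint f s := by
    intro s hs hsc
    have hmono : StrictMonoOn (Fint f) (Icc β s) := by
      refine strictMonoOn_of_deriv_pos (convex_Icc β s)
        (fun t ht => (hdF ht.1 (hlt ht.2 hsc)).continuousAt.continuousWithinAt) fun t ht => ?_
      rw [interior_Icc] at ht
      rw [(hdF ht.1.le (hlt ht.2.le hsc)).deriv]
      exact hpos t (hbβ.trans ht.1) (hlt ht.2.le hsc)
    simpa [hFβ] using hmono (left_mem_Icc.2 hs.le) (right_mem_Icc.2 hs.le) hs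
  have hkey : ∀ {s : ℝ}, β < s → (s : EReal) < c →
      (1 + s * deriv f s / f s) * Fint f s < s * f s := by
    intro s hs hsc
    set k := s * deriv f s / f s with hk
    have hd : ∀ t ∈ Icc β s, HasDerivAt (fun t => t * f t - (1 + k) * Fint f t)
        (1 * f t + t * deriv f t - (1 + k) * f t) t := fun t ht =>
      (hdsf ht.1 (hlt ht.2 hsc)).sub ((hdF ht.1 (hlt ht.2 hsc)).const_mul _)
    have hmono : MonotoneOn (fun t => t * f t - (1 + k) * Fint f t) (Icc β s) := by
      refine monotoneOn_of_deriv_nonneg (convex_Icc β s)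
        (fun t ht => (hd t ht).continuousAt.continuousWithinAt)
        (fun t ht => (hd t (interior_subset ht)).differentiableAt.differentiableWithinAt)
        fun t ht => ?_
      rw [(hd t (interior_subset ht)).deriv]
      rw [interior_Icc] at ht
      have hft : 0 < f t := hpos t (hbβ.trans ht.1) (hlt ht.2.le hsc)
      have hlow : k < t * deriv f t / f t :=
        hdec ⟨ht.1.le, hlt ht.2.le hsc⟩ ⟨hs.le, hsc⟩ ht.2
      rw [lt_div_iff₀ hft] at hlow
      linarith
    have hle := hmono (left_mem_Icc.2 hs.le) (right_mem_Icc.2 hs.le) hs.le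
    have hβf : 0 < β * f β := mul_pos hβ (hpos β hbβ (hlt hs.le hsc))
    simp only [hFβ, mul_zero, sub_zero] at hle
    linarith
  have hd : ∀ s ∈ {s : ℝ | β < s ∧ (s : EReal) < c}, HasDerivAt (fun s => s * f s / Fint f s)
      (((1 * f s + s * deriv f s) * Fint f s - s * f s * f s) / Fint f s ^ 2) s := fun s hs =>
    (hdsf hs.1.le hs.2).div (hdF hs.1.le hs.2) (hFpos hs.1 hs.2).ne'
  have hconv : Convex ℝ {s : ℝ | β < s ∧ (s : EReal) < c} := by
    refine OrdConnected.convex ⟨fun x hx y hy z hz => ?_⟩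
    exact ⟨hx.1.trans_le hz.1, hlt hz.2 hy.2⟩
  refine strictAntiOn_of_deriv_neg hconv
    (fun s hs => (hd s hs).continuousAt.continuousWithinAt) fun s hs => ?_
  replace hs := interior_subset hs
  rw [(hd s hs).deriv]
  have hfs : 0 < f s := hpos s (hbβ.trans hs.1) hs.2
  refine div_neg_of_neg_of_pos ?_ (pow_pos (hFpos hs.1 hs.2) 2)
  have hmul := mul_lt_mul_of_pos_right (hkey hs.1 hs.2) hfs
  have hsplit : (1 + s * deriv f s / f s) * Fint f s * f s =
      (1 * f s + s * deriv f s) * Fint f s := by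
    field_simp
  linarith
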